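/- Let n ≥ 2 and 1 ≤ m ≤ n−1, and let a_1,…,a_{n−1} be positive integers satisfying a_1 > a_2 > ⋯ > a_{n−m} and a_{n−m} < a_{n−m+1} < ⋯ < a_{n−1}; set λ := Σ_{i=1}^{n−1} a_i α_i. Then, in ℚ(q), Σ_{w ∈ W^m} (−1)^{ε(w)} q^{−D(w,λ)} = q^{−Σ_{i=1}^{n−1} a_i} · (q^{n·a_{n−m}} − 1) · ∏_{i=1}^{n−m−1} (q^{(i+1)a_i − i·a_{i+1}} − 1) · ∏_{j=1}^{m−1} (q^{(j+1)a_{n−j} − j·a_{n−j−1}} − 1). -/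

import Mathlib

/-- The positive root `α_{i,j} = e_i − e_j` of type `A_{n−1}` as a vector (1-based indices). -/
noncomputable def rootR (i j : ℕ) : ℕ → ℝ := fun k => (if k = i then 1 else 0) - (if k = j then 1 else 0)

/-- The longest element of the symmetric group on the interval `{a, …, b}`,
viewed as a permutation of `ℕ` fixing everything else. -/
def wLong (a b : ℕ) : Equiv.Perm ℕ :=
  Function.Involutive.toPerm (fun k => if a ≤ k ∧ k ≤ b then a + b - k else k)
    (by intro k; dsimp only; split_ifs <;> omega)

/-- `|w(α_i)|`: whichever of `±(e_{w(i)} − e_{w(i+1)})` is a positive root. -/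
noncomputable def absRoot (w : Equiv.Perm ℕ) (i : ℕ) : ℕ → ℝ :=
  rootR (min (w i) (w (i + 1))) (max (w i) (w (i + 1)))

/-- Permutations of `{a, …, b}`: permutations of `ℕ` fixing every element outside `[a,b]`. -/
def SB (a b : ℕ) : Set (Equiv.Perm ℕ) := {w | ∀ k ∉ Finset.Icc a b, w k = k}

/-- The cone generated by the positive roots `|w(α_i)|`, `a ≤ i ≤ b − 1`. -/
noncomputable def ConeB (a b : ℕ) (w : Equiv.Perm ℕ) : Set (ℕ → ℝ) :=
  {v | ∃ c : ℕ → ℝ, (∀ i ∈ Finset.Icc a (b - 1), 0 ≤ c i) ∧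
      v = ∑ i ∈ Finset.Icc a (b - 1), c i • absRoot w i}

/-- Vectors `Σ_{i=a}^{b−1} c_i α_i` with `c_a > c_{a+1} > ⋯ > c_{b−1} > 0`. -/
def decSet (a b : ℕ) : Set (ℕ → ℝ) :=
  {v | ∃ c : ℕ → ℝ, (∀ i, a ≤ i → i + 1 ≤ b - 1 → c (i + 1) < c i) ∧ 0 < c (b - 1) ∧
      v = ∑ i ∈ Finset.Icc a (b - 1), c i • rootR i (i + 1)}

/-- Vectors `Σ_{i=a}^{b−1} c_i α_i` with `0 < c_a < c_{a+1} < ⋯ < c_{b−1}`. -/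
def incSet (a b : ℕ) : Set (ℕ → ℝ) :=
  {v | ∃ c : ℕ → ℝ, 0 < c a ∧ (∀ i, a ≤ i → i + 1 ≤ b - 1 → c i < c (i + 1)) ∧
      v = ∑ i ∈ Finset.Icc a (b - 1), c i • rootR i (i + 1)}

def Wdec (a b : ℕ) : Set (Equiv.Perm ℕ) := {w | w ∈ SB a b ∧ decSet a b ⊆ ConeB a b w}

def Winc (a b : ℕ) : Set (Equiv.Perm ℕ) := {w | w ∈ SB a b ∧ incSet a b ⊆ ConeB a b w}

/-- The chamber `C_m ⊆ ℝ^n`. -/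
def Cm (n m : ℕ) : Set (ℕ → ℝ) :=
  {v | ∃ a : ℕ → ℝ,
    (∀ i, 1 ≤ i → i + 1 ≤ n - m → a (i + 1) < a i) ∧
    (∀ i, n - m ≤ i → i + 1 ≤ n - 1 → a i < a (i + 1)) ∧
    0 < a (n - m) ∧
    v = ∑ i ∈ Finset.Icc 1 (n - 1), a i • rootR i (i + 1)}

/-- `W^m`: permutations of `{1,…,n}` whose cone contains `C_m`. -/
def Wm (n m : ℕ) : Set (Equiv.Perm ℕ) := {w | w ∈ SB 1 n ∧ Cm n m ⊆ ConeB 1 n w}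

noncomputable def q : RatFunc ℚ := RatFunc.X

/-- `ε(w) = #{i ∈ {1,…,n−1} : w(i) < w(i+1)}`. -/
def eps (n : ℕ) (w : Equiv.Perm ℕ) : ℕ :=
  ((Finset.Icc 1 (n - 1)).filter fun i => w i < w (i + 1)).card

/-- `D(w, Σ_{i=1}^{N} a_i α_i) = Σ_{i=1}^{N} a_i (w⁻¹(i+1) − w⁻¹(i))`. -/
def D (N : ℕ) (w : Equiv.Perm ℕ) (a : ℕ → ℤ) : ℤ :=
  ∑ i ∈ Finset.Icc 1 N, a i * ((w⁻¹ (i + 1) : ℤ) - (w⁻¹ i : ℤ))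


def ascL : List ℕ → ℕ
  | x :: y :: t => (if x < y then 1 else 0) + ascL (y :: t)
  | _ => 0

def EL (b : ℕ → ℤ) : List ℕ → ℤ
  | [] => 0
  | x :: t => EL b t + (b x + (t.map b).sum)

lemma EL_append (b : ℕ → ℤ) (u v : List ℕ) :
    EL b (u ++ v) = EL b u + EL b v + u.length * (v.map b).sum := by
  induction u with
  | nil => simp [EL]
  | cons x u ih =>
    simp only [List.cons_append, EL, ih, List.map_append, List.sum_append, List.length_cons]
    push_cast
    ring

lemma ascL_append_lt (u v : List ℕ) (hu : u ≠ []) (hv : v ≠ [])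
    (h : ∀ x ∈ u, ∀ y ∈ v, x < y) : ascL (u ++ v) = ascL u + ascL v + 1 := by
  induction u with
  | nil => exact absurd rfl hu
  | cons x u ih =>
    cases u with
    | nil =>
      cases v with
      | nil => exact absurd rfl hv
      | cons y v =>
        have := h x (by simp) y (by simp)
        simp [ascL, this]; omega
    | cons x' u =>
      have := ih (by simp) (fun x hx => h x (List.mem_cons_of_mem _ hx))
      simp only [List.cons_append] at this ⊢
      simp only [ascL, this]; omega

lemma ascL_append_gt (u v : List ℕ)
    (h : ∀ x ∈ u, ∀ y ∈ v, y < x) : ascL (u ++ v) = ascL u + ascL v := by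
  induction u with
  | nil => simp [ascL]
  | cons x u ih =>
    cases u with
    | nil =>
      cases v with
      | nil => simp [ascL]
      | cons y v =>
        have := h x (by simp) y (by simp)
        simp [ascL]; omega
    | cons x' u =>
      have := ih (fun x hx => h x (List.mem_cons_of_mem _ hx))
      simp only [List.cons_append] at this ⊢
      simp only [ascL, this]; omega

noncomputable def wt (b : ℕ → ℤ) (l : List ℕ) : RatFunc ℚ := (-1) ^ ascL l * q ^ EL b l

lemma q_ne : q ≠ 0 := RatFunc.X_ne_zero

/-- words built from the inside out -/
def BL (f : ℕ → ℕ) : ℕ → List (List ℕ)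
  | 0 => [[f 0]]
  | k + 1 => (BL f k).map (fun l => f (k + 1) :: l) ++ (BL f k).map (fun l => l ++ [f (k + 1)])

lemma BL_perm (f : ℕ → ℕ) (k : ℕ) : ∀ l ∈ BL f k, l.Perm ((List.range (k + 1)).map f) := by
  induction k with
  | zero => intro l hl; simp [BL] at hl; subst hl; simp
  | succ k ih =>
    intro l hl
    rw [List.range_succ, List.map_append]
    simp only [BL, List.mem_append, List.mem_map] at hl
    rcases hl with ⟨l', h', rfl⟩ | ⟨l', h', rfl⟩
    · exact (List.perm_append_singleton _ _).symm.trans ((ih l' h').append_right _)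
    · exact (ih l' h').append_right _

lemma BL_reverse (f : ℕ → ℕ) (k : ℕ) : ∀ l ∈ BL f k, l.reverse ∈ BL f k := by
  induction k with
  | zero => intro l hl; simp [BL] at hl; subst hl; simp [BL]
  | succ k ih =>
    intro l hl
    simp only [BL, List.mem_append, List.mem_map] at hl ⊢
    rcases hl with ⟨l', h', rfl⟩ | ⟨l', h', rfl⟩
    · right; exact ⟨l'.reverse, ih _ h', by simp⟩
    · left; exact ⟨l'.reverse, ih _ h', by simp⟩

lemma BL_mem_iff {f : ℕ → ℕ} {k : ℕ} {l : List ℕ} (h : l ∈ BL f k) (x : ℕ) :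
    x ∈ l ↔ ∃ i, i < k + 1 ∧ f i = x := by
  rw [(BL_perm f k l h).mem_iff]; simp

lemma BL_length {f : ℕ → ℕ} {k : ℕ} {l : List ℕ} (h : l ∈ BL f k) : l.length = k + 1 := by
  rw [(BL_perm f k l h).length_eq]; simp

lemma BL_ne_nil {f : ℕ → ℕ} {k : ℕ} {l : List ℕ} (h : l ∈ BL f k) : l ≠ [] := by
  intro h0; have := BL_length h; simp [h0] at this

lemma BL_nodup (f : ℕ → ℕ) (k : ℕ) (hf : ∀ i j, i < j → j ≤ k → f i ≠ f j) :
    (BL f k).Nodup := by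
  induction k with
  | zero => simp [BL]
  | succ k ih =>
    have ih := ih (fun i j h1 h2 => hf i j h1 (by omega))
    rw [BL, List.nodup_append]
    refine ⟨ih.map (fun a b h => by simpa using h), ih.map (fun a b h => by simpa using h), ?_⟩
    intro x hx y hy hxy
    simp only [List.mem_map] at hx hy
    obtain ⟨l1, h1, rfl⟩ := hx
    obtain ⟨l2, h2, rfl⟩ := hy
    cases l2 with
    | nil => exact BL_ne_nil h2 rfl
    | cons z l2 =>
      simp only [List.cons_append, List.cons.injEq] at hxy
      obtain ⟨i, hi, hi'⟩ := (BL_mem_iff h2 z).1 (by simp)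
      exact hf i (k + 1) (by omega) le_rfl (hi'.trans hxy.1.symm)

lemma wt_cons (b : ℕ → ℤ) (z : ℕ) (l : List ℕ) (hl : l ≠ []) (σ : Prop) [Decidable σ]
    (h : ∀ x ∈ l, if σ then z < x else x < z) :
    wt b (z :: l) = wt b l * ((if σ then -1 else 1) * q ^ (b z + (l.map b).sum)) := by
  have : ascL (z :: l) = ascL l + if σ then 1 else 0 := by
    split_ifs with hs
    · simp only [hs, if_true] at h
      have := ascL_append_lt [z] l (by simp) hl (by simpa using h)
      simpa [ascL] using this
    · simp only [hs, if_false] at h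
      have := ascL_append_gt [z] l (by simpa using h)
      simpa [ascL] using this
  rw [wt, wt, this, EL, zpow_add₀ q_ne]
  split_ifs
  · rw [pow_succ]; ring
  · simp; ring

lemma wt_snoc (b : ℕ → ℤ) (z : ℕ) (l : List ℕ) (hl : l ≠ []) (σ : Prop) [Decidable σ]
    (h : ∀ x ∈ l, if σ then z < x else x < z) :
    wt b (l ++ [z]) = wt b l * ((if σ then 1 else -1) * q ^ ((l.length + 1 : ℤ) * b z)) := by
  have : ascL (l ++ [z]) = ascL l + if σ then 0 else 1 := by
    split_ifs with hs
    · simp only [hs, if_true] at h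
      have := ascL_append_gt l [z] (by simpa using h)
      simpa [ascL] using this
    · simp only [hs, if_false] at h
      have := ascL_append_lt l [z] hl (by simp) (by simpa using h)
      simpa [ascL] using this
  have e : EL b (l ++ [z]) = EL b l + (l.length + 1 : ℤ) * b z := by
    rw [EL_append]; simp [EL]; ring
  rw [wt, wt, this, e, zpow_add₀ q_ne]
  split_ifs
  · simp; ring
  · rw [pow_succ]; ring

lemma BL_sum_succ (b : ℕ → ℤ) (f : ℕ → ℕ) (k : ℕ) (σ : Prop) [Decidable σ]
    (h : ∀ i < k + 1, if σ then f (k + 1) < f i else f i < f (k + 1)) :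
    ((BL f (k + 1)).map (wt b)).sum = ((BL f k).map (wt b)).sum *
      ((if σ then -1 else 1) * (q ^ (∑ i ∈ Finset.range (k + 2), b (f i)) -
        q ^ ((k + 2 : ℤ) * b (f (k + 1))))) := by
  rw [BL, List.map_append, List.sum_append, List.map_map, List.map_map, mul_sub, mul_sub,
    sub_eq_add_neg]
  have key : ∀ l ∈ BL f k, ∀ x ∈ l, if σ then f (k + 1) < x else x < f (k + 1) := by
    intro l hl x hx
    obtain ⟨i, hi, rfl⟩ := (BL_mem_iff hl x).1 hx
    exact h i hi
  congr 1
  · rw [← List.sum_map_mul_right]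
    congr 1
    apply List.map_congr_left
    intro l hl
    simp only [Function.comp]
    rw [wt_cons b _ l (BL_ne_nil hl) σ (key l hl)]
    congr 3
    rw [((BL_perm f k l hl).map b).sum_eq, Finset.sum_range_succ, add_comm, List.map_map]
    congr 1
    
  · rw [neg_mul_eq_mul_neg, ← List.sum_map_mul_right]
    congr 1
    apply List.map_congr_left
    intro l hl
    simp only [Function.comp]
    rw [wt_snoc b _ l (BL_ne_nil hl) σ (key l hl), BL_length hl]
    have : ((k + 1 : ℕ) + 1 : ℤ) = k + 2 := by push_cast; ring
    rw [this]
    split_ifs <;> ring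

lemma BL_of_shape (f : ℕ → ℕ) (r : ℕ → ℕ → Prop) (hr : ∀ x y, r x y → ¬ r y x) (k : ℕ)
    (hf : ∀ i j, i < j → j ≤ k → r (f i) (f j)) (p s : List ℕ)
    (hperm : (p ++ f 0 :: s).Perm ((List.range (k + 1)).map f))
    (hp : (p ++ [f 0]).Pairwise (fun x y => r y x)) (hs : (f 0 :: s).Pairwise r) :
    p ++ f 0 :: s ∈ BL f k := by
  induction k generalizing p s with
  | zero =>
    have := hperm.length_eq
    simp at this
    obtain ⟨rfl, rfl⟩ : p = [] ∧ s = [] := by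
      constructor <;> apply List.eq_nil_of_length_eq_zero <;> omega
    simp [BL]
  | succ k ih =>
    have hf' : ∀ i j, i < j → j ≤ k → r (f i) (f j) := fun i j h1 h2 => hf i j h1 (by omega)
    have hmem : f (k + 1) ∈ p ++ f 0 :: s := by
      rw [hperm.mem_iff]; simp; exact ⟨k + 1, by omega, rfl⟩
    have hle : ∀ y ∈ p ++ f 0 :: s, ¬ r (f (k + 1)) y := by
      intro y hy hc
      rw [hperm.mem_iff] at hy
      simp at hy
      obtain ⟨i, hi, rfl⟩ := hy
      rcases (by omega : i < k + 1 ∨ i = k + 1) with h | rfl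
      · exact hr _ _ hc (hf i (k + 1) h le_rfl)
      · exact hr _ _ hc hc
    have hne : f (k + 1) ≠ f 0 := by
      intro h
      have := hf 0 (k + 1) (by omega) le_rfl
      rw [h] at this; exact hr _ _ this this
    rw [List.range_succ, List.map_append] at hperm
    simp only [List.mem_append, List.mem_cons, hne, false_or] at hmem
    simp only [BL, List.mem_append, List.mem_map]
    rcases hmem with h | h
    · left
      obtain ⟨p1, p2, rfl⟩ := List.append_of_mem h
      cases p1 with
      | nil =>
        refine ⟨p2 ++ f 0 :: s, ?_, by simp⟩
        apply ih hf' p2 s _ _ hs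
        · have := hperm.trans (List.perm_append_singleton _ _)
          simpa using this
        · simp only [List.nil_append, List.cons_append] at hp
          exact hp.of_cons
      | cons y p1 =>
        exfalso
        simp only [List.cons_append, List.append_assoc, List.pairwise_cons] at hp
        exact hle y (by simp) (hp.1 _ (by simp))
    · right
      obtain ⟨s1, s2, rfl⟩ := List.append_of_mem h
      rcases List.eq_nil_or_concat s2 with rfl | ⟨s2, y, rfl⟩
      · refine ⟨p ++ f 0 :: s1, ?_, by simp⟩
        apply ih hf' p s1 _ hp
        · rw [← List.cons_append, List.pairwise_append] at hs
          exact hs.1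
        · have : (p ++ f 0 :: s1) ++ [f (k + 1)] = p ++ f 0 :: (s1 ++ [f (k + 1)]) := by simp
          rw [← this] at hperm
          exact (List.perm_append_right_iff _).1 hperm
      · exfalso
        have : f 0 :: (s1 ++ f (k + 1) :: s2.concat y) = (f 0 :: s1) ++ (f (k + 1) :: s2.concat y) := by
          simp
        rw [this, List.pairwise_append] at hs
        exact hle y (by simp) ((List.pairwise_cons.1 hs.2.1).1 y (by simp))

lemma BL_shape (f : ℕ → ℕ) (r : ℕ → ℕ → Prop) (k : ℕ)
    (hf : ∀ i j, i < j → j ≤ k → r (f i) (f j)) (l : List ℕ) (hl : l ∈ BL f k) :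
    ∃ p s, l = p ++ f 0 :: s ∧
    (p ++ [f 0]).Pairwise (fun x y => r y x) ∧ (f 0 :: s).Pairwise r := by
  induction k generalizing l with
  | zero => simp [BL] at hl; exact ⟨[], [], by simp [hl]⟩
  | succ k ih =>
    have hf' : ∀ i j, i < j → j ≤ k → r (f i) (f j) := fun i j h1 h2 => hf i j h1 (by omega)
    simp only [BL, List.mem_append, List.mem_map] at hl
    rcases hl with ⟨l', h', rfl⟩ | ⟨l', h', rfl⟩
    all_goals
      have key : ∀ x ∈ l', r x (f (k + 1)) := by
        intro x hx
        obtain ⟨i, hi, rfl⟩ := (BL_mem_iff h' x).1 hx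
        exact hf _ _ hi le_rfl
      obtain ⟨p, s, rfl, h1, h2⟩ := ih hf' l' h'
    · refine ⟨f (k + 1) :: p, s, by simp, ?_, h2⟩
      rw [List.cons_append, List.pairwise_cons]
      exact ⟨fun x hx => key x (by simp at hx ⊢; tauto), h1⟩
    · refine ⟨p, s ++ [f (k + 1)], by simp, h1, ?_⟩
      rw [← List.cons_append, List.pairwise_append]
      refine ⟨h2, by simp, ?_⟩
      intro x hx y hy
      simp only [List.mem_singleton] at hy
      subst hy
      exact key x (List.mem_append_right _ hx)

lemma FV_sum (A : ℕ → ℤ) (hA0 : A 0 = 0) (L : ℕ) :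
    ((BL (fun i => i + 1) L).map (wt (fun k => A k - A (k - 1)))).sum =
      q ^ ((L + 1 : ℤ) * A (L + 1) - ∑ i ∈ Finset.Icc 1 L, A i) *
      ∏ i ∈ Finset.Icc 1 L, (q ^ (((i : ℤ) + 1) * A i - (i : ℤ) * A (i + 1)) - 1) := by
  have hs : ∀ k, ∑ i ∈ Finset.range k, (A (i + 1) - A (i + 1 - 1)) = A k := by
    intro k
    simp only [Nat.add_sub_cancel]
    rw [Finset.sum_range_sub, hA0, sub_zero]
  induction L with
  | zero => simp [BL, wt, ascL, EL, hA0]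
  | succ k ih =>
    rw [BL_sum_succ _ _ _ False (by intro i hi; simp; omega), ih, hs,
      Finset.prod_Icc_succ_top (by omega), Finset.sum_Icc_succ_top (by omega)]
    simp only [if_false, one_mul]
    have e1 : q ^ A (k + 2) - q ^ ((k + 2 : ℤ) * (A (k + 1 + 1) - A (k + 1 + 1 - 1))) =
        q ^ ((k + 2 : ℤ) * (A (k + 2) - A (k + 1))) *
        (q ^ (((k + 1 : ℕ) + 1 : ℤ) * A (k + 1) - ((k + 1 : ℕ) : ℤ) * A (k + 1 + 1)) - 1) := by
      rw [mul_sub (q ^ _), ← zpow_add₀ q_ne, mul_one]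
      congr 2
      push_cast
      ring_nf
    have e2 : q ^ (((k + 1 : ℕ) + 1 : ℤ) * A (k + 1 + 1) - (∑ i ∈ Finset.Icc 1 k, A i + A (k + 1))) =
        q ^ ((k + 1 : ℤ) * A (k + 1) - ∑ i ∈ Finset.Icc 1 k, A i) *
        q ^ ((k + 2 : ℤ) * (A (k + 2) - A (k + 1))) := by
      rw [← zpow_add₀ q_ne]
      congr 1
      push_cast
      ring_nf
    rw [e1, e2]
    ring

lemma FL_sum (A : ℕ → ℤ) (n : ℕ) (hAn : A n = 0) (M : ℕ) (hM : M + 1 ≤ n) :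
    ((BL (fun i => n - i) M).map (wt (fun k => A k - A (k - 1)))).sum =
      q ^ (- ∑ i ∈ Finset.range (M + 1), A (n - i - 1)) *
      ∏ j ∈ Finset.Icc 1 M, (q ^ (((j : ℤ) + 1) * A (n - j) - (j : ℤ) * A (n - j - 1)) - 1) := by
  have hs : ∀ k, ∑ i ∈ Finset.range k, (A (n - i) - A (n - i - 1)) = - A (n - k) := by
    intro k
    simp only [Nat.sub_sub]
    have := Finset.sum_range_sub' (fun i => A (n - i)) k
    simp only [Nat.sub_zero, hAn] at this
    rw [this]; ring
  induction M with
  | zero => simp [BL, wt, ascL, EL, hAn]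
  | succ k ih =>
    rw [BL_sum_succ _ _ _ True (by intro i hi; simp; omega), ih (by omega), hs,
      Finset.prod_Icc_succ_top (by omega), Finset.sum_range_succ _ (k + 1)]
    simp only [if_true]
    have e1 : -1 * (q ^ (-A (n - (k + 2))) - q ^ ((k + 2 : ℤ) * (A (n - (k + 1)) - A (n - (k + 1) - 1)))) =
        q ^ (-A (n - (k + 1) - 1)) *
        (q ^ (((k + 1 : ℕ) + 1 : ℤ) * A (n - (k + 1)) - ((k + 1 : ℕ) : ℤ) * A (n - (k + 1) - 1)) - 1) := by
      have : n - (k + 2) = n - (k + 1) - 1 := by omega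
      rw [this, mul_sub (q ^ _), ← zpow_add₀ q_ne, mul_one, mul_sub (-1 : RatFunc ℚ), neg_one_mul, neg_one_mul, sub_neg_eq_add,
        add_comm, ← sub_eq_add_neg]
      congr 2
      push_cast
      ring_nf
    rw [e1, neg_add, zpow_add₀ q_ne]
    ring

def WS (n L M : ℕ) : Finset (List ℕ) :=
  ((BL (fun i => i + 1) L).toFinset ×ˢ (BL (fun i => n - i) M).toFinset).image (fun p => p.1 ++ p.2) ∪
  ((BL (fun i => i + 1) L).toFinset ×ˢ (BL (fun i => n - i) M).toFinset).image (fun p => p.2 ++ p.1)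

lemma WS_sum (A : ℕ → ℤ) (n L M : ℕ) (hn : n = L + M + 2) (hA0 : A 0 = 0) (hAn : A n = 0) :
    ∑ l ∈ WS n L M, wt (fun k => A k - A (k - 1)) l =
      q ^ (-(∑ i ∈ Finset.Icc 1 (n - 1), A i)) * (q ^ ((n : ℤ) * A (L + 1)) - 1) *
        (∏ i ∈ Finset.Icc 1 L, (q ^ (((i : ℤ) + 1) * A i - (i : ℤ) * A (i + 1)) - 1)) *
        (∏ j ∈ Finset.Icc 1 M, (q ^ (((j : ℤ) + 1) * A (n - j) - (j : ℤ) * A (n - j - 1)) - 1)) := by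
  set b : ℕ → ℤ := fun k => A k - A (k - 1) with hb
  have nV := BL_nodup (fun i => i + 1) L (by intro i j h _; simp; omega)
  have nL := BL_nodup (fun i => n - i) M (by intro i j h _; simp; omega)
  have hlt : ∀ u ∈ BL (fun i => i + 1) L, ∀ v ∈ BL (fun i => n - i) M, ∀ x ∈ u, ∀ y ∈ v, x < y := by
    intro u hu v hv x hx y hy
    obtain ⟨i, hi, rfl⟩ := (BL_mem_iff hu x).1 hx
    obtain ⟨j, hj, rfl⟩ := (BL_mem_iff hv y).1 hy
    omega
  have sV : ∀ u ∈ BL (fun i => i + 1) L, (u.map b).sum = A (L + 1) := by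
    intro u hu
    rw [((BL_perm _ _ u hu).map b).sum_eq, List.map_map]
    have := Finset.sum_range_sub A (L + 1)
    rw [hA0, sub_zero] at this
    rw [← this]
    rfl
  have sL : ∀ u ∈ BL (fun i => n - i) M, (u.map b).sum = - A (L + 1) := by
    intro u hu
    rw [((BL_perm _ _ u hu).map b).sum_eq, List.map_map]
    have := Finset.sum_range_sub' (fun i => A (n - i)) (M + 1)
    simp only [Nat.sub_zero, hAn] at this
    rw [show n - (M + 1) = L + 1 by omega, zero_sub] at this
    rw [← this]
    simp only [← Nat.sub_sub]
    rfl
  rw [WS, Finset.sum_union, Finset.sum_image, Finset.sum_image, ← Finset.sum_add_distrib]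
  · have : ∀ p ∈ (BL (fun i => i + 1) L).toFinset ×ˢ (BL (fun i => n - i) M).toFinset,
        wt b (p.1 ++ p.2) + wt b (p.2 ++ p.1) = wt b p.1 * wt b p.2 *
          (q ^ (-(L + 1 : ℤ) * A (L + 1)) * (q ^ ((n : ℤ) * A (L + 1)) - 1)) := by
      rintro ⟨u, v⟩ hp
      simp only [Finset.mem_product, List.mem_toFinset] at hp ⊢
      obtain ⟨hu, hv⟩ := hp
      have h := hlt u hu v hv
      rw [wt, wt, ascL_append_lt u v (BL_ne_nil hu) (BL_ne_nil hv) h,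
        ascL_append_gt v u (fun x hx y hy => h y hy x hx), EL_append, EL_append,
        sV u hu, sL v hv, BL_length hu, BL_length hv, wt, wt, mul_sub, ← zpow_add₀ q_ne]
      have e1 : (-(L + 1 : ℤ) * A (L + 1) + (n : ℤ) * A (L + 1)) = ((M + 1 : ℕ) : ℤ) * A (L + 1) := by
        rw [hn]; push_cast; ring
      have e2 : ((L + 1 : ℕ) : ℤ) * - A (L + 1) = -(L + 1 : ℤ) * A (L + 1) := by
        push_cast; ring
      rw [e1, e2, zpow_add₀ q_ne, zpow_add₀ q_ne, zpow_add₀ q_ne, zpow_add₀ q_ne, pow_add, pow_add, pow_add]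
      ring
    rw [Finset.sum_congr rfl this, ← Finset.sum_mul, Finset.sum_product]
    simp only [← Finset.mul_sum]
    rw [← Finset.sum_mul, List.sum_toFinset _ nV, List.sum_toFinset _ nL, hb, FV_sum A hA0, FL_sum A n hAn M (by omega)]
    have e3 : ∑ i ∈ Finset.Icc 1 (n - 1), A i = ∑ i ∈ Finset.Icc 1 L, A i +
        ∑ i ∈ Finset.range (M + 1), A (n - i - 1) := by
      have h1 : Finset.Icc 1 (n - 1) = Finset.Ico 1 (L + 1 + (M + 1)) := by ext; simp; omega
      have h2 : Finset.Icc 1 L = Finset.Ico 1 (L + 1) := by ext; simp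
      rw [h1, h2, ← Finset.sum_Ico_consecutive _ (by omega : 1 ≤ L + 1) (by omega : L + 1 ≤ L + 1 + (M + 1))]
      congr 1
      rw [Finset.sum_Ico_eq_sum_range, ← Finset.sum_range_reflect]
      simp only [Nat.add_sub_cancel_left]
      apply Finset.sum_congr rfl
      intro i hi
      simp only [Finset.mem_range] at hi
      congr 1; omega
    have e4 : q ^ (-(∑ i ∈ Finset.Icc 1 (n - 1), A i)) =
        q ^ ((L + 1 : ℤ) * A (L + 1) - ∑ i ∈ Finset.Icc 1 L, A i) *
        q ^ (- ∑ i ∈ Finset.range (M + 1), A (n - i - 1)) * q ^ (-(L + 1 : ℤ) * A (L + 1)) := by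
      rw [← zpow_add₀ q_ne, ← zpow_add₀ q_ne, e3]
      congr 1; ring
    rw [e4]
    ring
  · rintro ⟨u, v⟩ hp ⟨u', v'⟩ hp' h
    simp only [Finset.coe_product, Set.mem_prod, Finset.mem_coe, List.mem_toFinset] at hp hp' h
    obtain ⟨h1, h2⟩ := List.append_inj h (by rw [BL_length hp.2, BL_length hp'.2])
    rw [h1, h2]
  · rintro ⟨u, v⟩ hp ⟨u', v'⟩ hp' h
    simp only [Finset.coe_product, Set.mem_prod, Finset.mem_coe, List.mem_toFinset] at hp hp' h
    obtain ⟨h1, h2⟩ := List.append_inj h (by rw [BL_length hp.1, BL_length hp'.1])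
    rw [h1, h2]
  · rw [Finset.disjoint_left]
    intro l h1 h2
    simp only [Finset.mem_image, Finset.mem_product, List.mem_toFinset, Prod.exists] at h1 h2
    obtain ⟨u, v, ⟨hu, hv⟩, rfl⟩ := h1
    obtain ⟨u', v', ⟨hu', hv'⟩, h⟩ := h2
    cases u with
    | nil => exact BL_ne_nil hu rfl
    | cons x u =>
      cases v' with
      | nil => exact BL_ne_nil hv' rfl
      | cons y v' =>
        simp only [List.cons_append, List.cons.injEq] at h
        have := hlt _ hu _ hv' x (by simp) y (by simp)
        omega

structure Ch (n l : ℕ) (v : ℕ → ℝ) : Prop where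
  neg : ∀ k, 2 ≤ k → k ≤ l → v k < 0
  pos : ∀ k, l < k → k < n → 0 < v k
  sl : 0 < ∑ k ∈ Finset.Icc 1 l, v k
  s0 : ∑ k ∈ Finset.Icc 1 n, v k = 0
  out : ∀ k, k ∉ Finset.Icc 1 n → v k = 0

def Good (n l : ℕ) (w : List ℕ) : Prop :=
  ∀ v, Ch n l v → ∀ p x y t, w = p ++ x :: y :: t →
    (x < y → 0 ≤ ((p ++ [x]).map v).sum) ∧ (y < x → ((p ++ [x]).map v).sum ≤ 0)

lemma list_sum_neg (v : ℕ → ℝ) (P : List ℕ) (h : ∀ x ∈ P, v x < 0) :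
    (P.map v).sum ≤ 0 ∧ (P ≠ [] → (P.map v).sum < 0) := by
  induction P with
  | nil => simp
  | cons x P ih =>
    have h1 := (ih (fun y hy => h y (by simp [hy]))).1
    have h2 := h x (by simp)
    simp only [List.map_cons, List.sum_cons]
    exact ⟨by linarith, fun _ => by linarith⟩

lemma list_sum_pos' (v : ℕ → ℝ) (P : List ℕ) (h : ∀ x ∈ P, 0 < v x) :
    0 ≤ (P.map v).sum ∧ (P ≠ [] → 0 < (P.map v).sum) := by
  induction P with
  | nil => simp
  | cons x P ih =>
    have h1 := (ih (fun y hy => h y (by simp [hy]))).1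
    have h2 := h x (by simp)
    simp only [List.map_cons, List.sum_cons]
    exact ⟨by linarith, fun _ => by linarith⟩

lemma list_sum_ge (v : ℕ → ℝ) (P : List ℕ) (h : ∀ x ∈ P, -1 ≤ v x) :
    -(P.length : ℝ) ≤ (P.map v).sum := by
  induction P with
  | nil => simp
  | cons x P ih =>
    have h1 := ih (fun y hy => h y (by simp [hy]))
    have h2 := h x (by simp)
    simp only [List.map_cons, List.sum_cons, List.length_cons]
    push_cast
    linarith

lemma list_sum_big (v : ℕ → ℝ) (P : List ℕ) (n : ℕ) (hn : P.length ≤ n) (h : ∀ x ∈ P, -1 ≤ v x)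
    (r : ℕ) (hr : r ∈ P) (hvr : (n : ℝ) ≤ v r) : 0 < (P.map v).sum := by
  obtain ⟨P1, P2, rfl⟩ := List.append_of_mem hr
  have h1 := list_sum_ge v P1 (fun x hx => h x (by simp [hx]))
  have h2 := list_sum_ge v P2 (fun x hx => h x (by simp [hx]))
  simp only [List.length_append, List.length_cons] at hn
  have : ((P1.length + (P2.length + 1) : ℕ) : ℝ) ≤ n := by exact_mod_cast hn
  push_cast at this
  simp only [List.map_append, List.map_cons, List.sum_append, List.sum_cons]
  linarith

lemma list_sum_small (v : ℕ → ℝ) (P : List ℕ) (n : ℕ) (hn : P.length ≤ n) (h : ∀ x ∈ P, v x ≤ 1)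
    (r : ℕ) (hr : r ∈ P) (hvr : v r ≤ -(n : ℝ)) : (P.map v).sum < 0 := by
  have := list_sum_big (fun x => - v x) P n hn (fun x hx => by linarith [h x hx]) r hr (by linarith)
  have e : (P.map (fun x => - v x)).sum = - (P.map v).sum := by
    clear * -
    induction P with
    | nil => simp
    | cons x P ih => simp only [List.map_cons, List.sum_cons, ih]; ring
  linarith

noncomputable def wit (L M : ℕ) (α β : ℝ) : ℕ → ℝ := fun k =>
  if k = 0 then 0 else if k = 1 then α * L + 1 else if k ≤ L + 1 then -α
  else if k ≤ L + M + 1 then β else if k = L + M + 2 then -(β * M + 1) else 0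

lemma wit_Ch (L M : ℕ) (α β : ℝ) (hα : 0 < α) (hβ : 0 < β) :
    Ch (L + M + 2) (L + 1) (wit L M α β) := by
  have s1 : ∑ k ∈ Finset.Icc 1 (L + 1), wit L M α β k = 1 := by
    have : Finset.Icc 1 (L + 1) = insert 1 (Finset.Icc 2 (L + 1)) := by
      ext; simp only [Finset.mem_Icc, Finset.mem_insert]; omega
    rw [this, Finset.sum_insert (by simp),
      Finset.sum_congr rfl (g := fun _ => -α)]
    · simp [wit]; ring
    · intro k hk
      simp only [Finset.mem_Icc] at hk
      simp only [wit]
      rw [if_neg (by omega), if_neg (by omega), if_pos (by omega)]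
  constructor
  · intro k h1 h2
    simp only [wit]
    rw [if_neg (by omega), if_neg (by omega), if_pos (by omega)]
    linarith
  · intro k h1 h2
    simp only [wit]
    rw [if_neg (by omega), if_neg (by omega), if_neg (by omega), if_pos (by omega)]
    linarith
  · rw [s1]; norm_num
  · have : Finset.Icc 1 (L + M + 2) = insert (L + M + 2) (Finset.Icc 1 (L + 1) ∪ Finset.Icc (L + 2) (L + M + 1)) := by
      ext; simp only [Finset.mem_Icc, Finset.mem_insert, Finset.mem_union]; omega
    rw [this, Finset.sum_insert (by simp), Finset.sum_union, s1,
      Finset.sum_congr (s₁ := Finset.Icc (L + 2) (L + M + 1)) rfl (g := fun _ => β)]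
    · have h : L + M + 1 + 1 - (L + 2) = M := by omega
      simp [wit, h]; ring
    · intro k hk
      simp only [Finset.mem_Icc] at hk
      simp only [wit]
      rw [if_neg (by omega), if_neg (by omega), if_neg (by omega), if_pos (by omega)]
    · rw [Finset.disjoint_left]
      intro x; simp only [Finset.mem_Icc]; omega
  · intro k hk
    simp only [Finset.mem_Icc] at hk
    simp only [wit]
    split_ifs <;> first | rfl | omega

lemma sum_split {n l : ℕ} {v : ℕ → ℝ} (hv : Ch n l v) {P Q : List ℕ}
    (hw : (P ++ Q).Perm (List.range' 1 n)) : (P.map v).sum + (Q.map v).sum = 0 := by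
  rw [← List.sum_append, ← List.map_append, (hw.map v).sum_eq, ← hv.s0]
  rw [← List.sum_toFinset _ (List.nodup_range')]
  congr 1
  ext x; simp [List.mem_range'_1]; omega

lemma sum_A {n l : ℕ} (hl : l < n) {v : ℕ → ℝ} (hv : Ch n l v) {P : List ℕ} (hP : P.Nodup)
    (hsub : ∀ x ∈ P, 1 ≤ x ∧ x ≤ n) (h1 : 1 ∈ P) (hn : n ∉ P) : 0 < (P.map v).sum := by
  rw [← List.sum_toFinset _ hP]
  rw [← Finset.sum_filter_add_sum_filter_not P.toFinset (fun x => x ≤ l)]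
  have e1 : 0 ≤ ∑ x ∈ P.toFinset with ¬ x ≤ l, v x := by
    apply Finset.sum_nonneg
    intro x hx
    simp only [Finset.mem_filter, List.mem_toFinset] at hx
    apply le_of_lt
    apply hv.pos x (by omega)
    rcases (hsub x hx.1).2.lt_or_eq with h | rfl
    · exact h
    · exact absurd hx.1 hn
  have e2 : ∑ k ∈ Finset.Icc 1 l, v k ≤ ∑ x ∈ P.toFinset with x ≤ l, v x := by
    have hs : (P.toFinset.filter (fun x => x ≤ l)) ⊆ Finset.Icc 1 l := by
      intro x hx
      simp only [Finset.mem_filter, List.mem_toFinset] at hx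
      simp only [Finset.mem_Icc]
      exact ⟨(hsub x hx.1).1, hx.2⟩
    rw [← Finset.sum_sdiff hs]
    have : ∑ x ∈ Finset.Icc 1 l \ (P.toFinset.filter (fun x => x ≤ l)), v x ≤ 0 := by
      apply Finset.sum_nonpos
      intro x hx
      simp only [Finset.mem_sdiff, Finset.mem_Icc, Finset.mem_filter, List.mem_toFinset] at hx
      apply le_of_lt
      apply hv.neg x _ hx.1.2
      have : x ≠ 1 := by rintro rfl; exact hx.2 ⟨h1, hx.1.2⟩
      omega
    linarith
  have := hv.sl
  linarith

lemma chain_of_split (r : ℕ → ℕ → Prop) (l : List ℕ)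
    (h : ∀ p x y t, l = p ++ x :: y :: t → r x y) : l.IsChain r := by
  induction l with
  | nil => simp
  | cons x l ih =>
    cases l with
    | nil => simp
    | cons y l =>
      rw [List.isChain_cons_cons]
      refine ⟨h [] x y l rfl, ih ?_⟩
      intro p x' y' t e
      exact h (x :: p) x' y' t (by rw [e]; rfl)

lemma sorted_split (l : ℕ) (s : List ℕ) (hs : s.Pairwise (· < ·)) :
    ∃ s1 s2, s = s1 ++ s2 ∧ (∀ x ∈ s1, x ≤ l) ∧ (∀ x ∈ s2, l < x) := by
  induction s with
  | nil => exact ⟨[], [], by simp⟩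
  | cons x s ih =>
    rw [List.pairwise_cons] at hs
    by_cases hx : x ≤ l
    · obtain ⟨s1, s2, rfl, h1, h2⟩ := ih hs.2
      refine ⟨x :: s1, s2, rfl, ?_, h2⟩
      intro y hy
      rcases List.mem_cons.1 hy with rfl | hy
      · exact hx
      · exact h1 y hy
    · refine ⟨[], x :: s, rfl, by simp, ?_⟩
      intro y hy
      rcases List.mem_cons.1 hy with rfl | hy
      · omega
      · have := hs.1 y hy; omega

lemma good_reverse {n l : ℕ} {w : List ℕ} (hw : w.Perm (List.range' 1 n)) (h : Good n l w) :
    Good n l w.reverse := by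
  intro v hv p x y t e
  have e' : w = t.reverse ++ y :: x :: p.reverse := by
    have := congrArg List.reverse e
    simpa using this
  have h' := h v hv _ _ _ _ e'
  have e2 : w = (t.reverse ++ [y]) ++ (x :: p.reverse) := by rw [e']; simp
  have hs := sum_split hv (e2 ▸ hw)
  have e3 : ((x :: p.reverse).map v).sum = ((p ++ [x]).map v).sum := by
    apply List.Perm.sum_eq
    apply List.Perm.map
    have := List.reverse_perm (p ++ [x])
    simpa using this
  rw [e3] at hs
  exact ⟨fun hh => by linarith [h'.2 hh], fun hh => by linarith [h'.1 hh]⟩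

lemma shape_of_good (L M n : ℕ) (hn : n = L + M + 2) (w : List ℕ)
    (hw : w.Perm (List.range' 1 n)) (hg : Good n (L + 1) w) (p mid s : List ℕ)
    (e : w = p ++ 1 :: (mid ++ n :: s)) :
    ∃ u ∈ BL (fun i => i + 1) L, ∃ v ∈ BL (fun i => n - i) M, w = u ++ v := by
  have hnd : w.Nodup := hw.nodup_iff.2 List.nodup_range'
  have hmem : ∀ x ∈ w, 1 ≤ x ∧ x ≤ n := by
    intro x hx
    rw [hw.mem_iff, List.mem_range'_1] at hx
    omega
  have hlen : w.length = n := by rw [hw.length_eq]; simp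
  have hnd' := hnd
  rw [e] at hnd'
  simp only [List.nodup_append, List.nodup_cons, List.mem_append, List.mem_cons, not_or] at hnd'
  obtain ⟨ndp, ⟨⟨h1m, h1n, h1s⟩, ndm, ⟨hns, nds⟩, hmns⟩, hpd⟩ := hnd'
  have hp1 : ∀ x ∈ p, x ≠ 1 := fun x hx => hpd x hx 1 (Or.inl rfl)
  have hpn : ∀ x ∈ p, x ≠ n := fun x hx => hpd x hx n (by simp)
  have hmn : ∀ x ∈ mid, x ≠ n := fun x hx => hmns x hx n (by simp)
  have hwp : ∀ x ∈ p, 1 ≤ x ∧ x ≤ n := fun x hx => hmem x (by rw [e]; simp [hx])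
  have hws : ∀ x ∈ s, 1 ≤ x ∧ x ≤ n := fun x hx => hmem x (by rw [e]; simp [hx])
  have hlp : p.length ≤ n := by rw [← hlen, e]; simp
  have hls : s.length ≤ n := by rw [← hlen, e]; simp; omega
  have hs1 : ∀ x ∈ s, x ≠ 1 := fun x hx h => h1s (h ▸ hx)
  have hsn : ∀ x ∈ s, x ≠ n := fun x hx h => hns (h ▸ hx)
  have hv1 := wit_Ch L M 1 n one_pos (by exact_mod_cast (by omega : 0 < n))
  have hv2 := wit_Ch L M n 1 (by exact_mod_cast (by omega : 0 < n)) one_pos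
  rw [← hn] at hv1 hv2
  have pL : ∀ x ∈ p, 2 ≤ x ∧ x ≤ L + 1 := by
    intro r hr
    have hr1 := hp1 r hr
    have hrn := hpn r hr
    have hr2 := hwp r hr
    refine ⟨by omega, ?_⟩
    by_contra hc
    rcases List.eq_nil_or_concat p with rfl | ⟨p', x, hpx⟩
    · simp at hr
    · rw [List.concat_eq_append] at hpx
      have hx1 := hp1 x (by rw [hpx]; simp)
      have hx2 := hwp x (by rw [hpx]; simp)
      have := (hg _ hv1 p' x 1 (mid ++ n :: s) (by rw [e, hpx]; simp)).2 (by omega)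
      rw [← hpx] at this
      have h3 := list_sum_big (wit L M 1 n) p n hlp ?_ r hr ?_
      · linarith
      · intro x hx
        have a1 := hp1 x hx
        have a2 := hpn x hx
        have a3 := hwp x hx
        simp only [wit]
        rw [if_neg (by omega), if_neg (by omega)]
        split_ifs
        · norm_num
        · have : (0:ℝ) ≤ n := by positivity
          linarith
        · omega
        · omega
      · simp only [wit]
        rw [if_neg (by omega), if_neg (by omega), if_neg (by omega), if_pos (by omega)]
  have sR : ∀ x ∈ s, L + 1 < x ∧ x < n := by
    intro r hr
    have hr1 := hs1 r hr
    have hrn := hsn r hr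
    have hr2 := hws r hr
    refine ⟨?_, by omega⟩
    by_contra hc
    rcases s with _ | ⟨y, s'⟩
    · simp at hr
    · have hy1 := hsn y (by simp)
      have hy2 := hws y (by simp)
      have e1 : w = (p ++ 1 :: mid) ++ n :: y :: s' := by rw [e]; simp
      have h1 := (hg _ hv2 (p ++ 1 :: mid) n y s' e1).2 (by omega)
      have e2 : w = ((p ++ 1 :: mid) ++ [n]) ++ (y :: s') := by rw [e]; simp
      have h2 := sum_split hv2 (e2 ▸ hw)
      have h3 := list_sum_small (wit L M n 1) (y :: s') n hls ?_ r hr ?_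
      · linarith
      · intro x hx
        have a1 := hs1 x hx
        have a2 := hsn x hx
        have a3 := hws x hx
        simp only [wit]
        rw [if_neg (by omega), if_neg (by omega)]
        split_ifs
        · have : (0:ℝ) ≤ n := by positivity
          linarith
        · exact le_rfl
        · omega
        · omega
      · simp only [wit]
        rw [if_neg (by omega), if_neg (by omega), if_pos (by omega)]
  have c1 : (p ++ [1]).Pairwise (fun x y => y < x) := by
    have : IsTrans ℕ (fun x y => y < x) := ⟨fun a b c h1 h2 => lt_trans h2 h1⟩
    rw [← List.isChain_iff_pairwise]
    apply chain_of_split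
    intro P x y t he
    have hw' : w = P ++ x :: y :: (t ++ (mid ++ n :: s)) := by
      have : w = (p ++ [1]) ++ (mid ++ n :: s) := by rw [e]; simp
      rw [this, he]; simp
    have hxy : x ≠ y := by
      rintro rfl
      rw [hw'] at hnd
      simp [List.nodup_append] at hnd
    have hPx : ∀ z ∈ P ++ [x], z ∈ p := by
      have : ∃ t'', p = (P ++ [x]) ++ t'' := by
        rcases List.eq_nil_or_concat t with rfl | ⟨t', z, rfl⟩
        · exact ⟨[], by simpa using (List.append_inj' (s₁ := p) (t₁ := [1]) (s₂ := P ++ [x]) (t₂ := [y]) (by rw [he]; simp) rfl).1⟩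
        · exact ⟨y :: t', by simpa using (List.append_inj' (s₁ := p) (t₁ := [1]) (s₂ := P ++ x :: y :: t') (t₂ := [z]) (by rw [he]; simp) rfl).1⟩
      obtain ⟨t'', h⟩ := this
      intro z hz
      rw [h]; exact List.mem_append_left _ hz
    have h1 := (hg _ hv1 P x y _ hw').1
    have h2 := (list_sum_neg (wit L M 1 n) (P ++ [x]) (fun z hz => hv1.neg z (pL z (hPx z hz)).1 (pL z (hPx z hz)).2)).2 (by simp)
    by_contra hc
    have := h1 (by omega)
    linarith
  have c2 : (1 :: mid ++ [n]).Pairwise (fun x y => x < y) := by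
    rw [← List.isChain_iff_pairwise]
    apply chain_of_split
    intro P x y t he
    have hw' : w = (p ++ P) ++ x :: y :: (t ++ s) := by
      have : w = p ++ (1 :: mid ++ [n]) ++ s := by rw [e]; simp
      rw [this, he]; simp
    have hxy : x ≠ y := by
      rintro rfl
      rw [hw'] at hnd
      simp [List.nodup_append] at hnd
    have h1 := (hg _ hv1 (p ++ P) x y _ hw').2
    have hw2 : w = ((p ++ P) ++ [x]) ++ (y :: (t ++ s)) := by rw [hw']; simp
    have hn1 : 1 ∈ (p ++ P) ++ [x] := by
      cases P with
      | nil => simp at he; simp [he.1]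
      | cons a P => simp at he; simp [he.1]
    have hn2 : n ∉ (p ++ P) ++ [x] := by
      have : n ∈ y :: t := by
        have h5 : (P ++ x :: y :: t).getLast? = some n := by rw [← he]; exact List.getLast?_concat
        have h6 : (P ++ x :: y :: t) = (P ++ [x]) ++ (y :: t) := by simp
        rw [h6, List.getLast?_append_of_ne_nil _ (by simp)] at h5
        exact List.mem_of_getLast? h5
      intro hc
      rw [hw2, List.nodup_append] at hnd
      exact hnd.2.2 n hc n (by rw [← List.cons_append]; exact List.mem_append_left _ this) rfl
    have h2 := sum_A (by omega) hv1 (P := (p ++ P) ++ [x])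
      (by rw [hw2, List.nodup_append] at hnd; exact hnd.1)
      (fun z hz => hmem z (by rw [hw2]; exact List.mem_append_left _ hz)) hn1 hn2
    by_contra hc
    have := h1 (by omega)
    linarith
  have c3 : (n :: s).Pairwise (fun x y => x > y) := by
    have : IsTrans ℕ (fun x y => x > y) := ⟨fun a b c h1 h2 => lt_trans h2 h1⟩
    rw [← List.isChain_iff_pairwise]
    apply chain_of_split
    intro P x y t he
    have hw' : w = (p ++ 1 :: mid ++ P) ++ x :: y :: t := by
      have : w = p ++ 1 :: mid ++ (n :: s) := by rw [e]; simp
      rw [this, he]; simp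
    have hxy : x ≠ y := by
      rintro rfl
      rw [hw'] at hnd
      simp [List.nodup_append] at hnd
    have h1 := (hg _ hv1 _ x y _ hw').1
    have hw2 : w = ((p ++ 1 :: mid ++ P) ++ [x]) ++ (y :: t) := by rw [hw']; simp
    have h3 := sum_split hv1 (hw2 ▸ hw)
    have hyt : ∀ z ∈ y :: t, z ∈ s := by
      intro z hz
      cases P with
      | nil => simp at he; rw [he.2]; exact hz
      | cons a P => simp at he; rw [he.2]; simp at hz ⊢; tauto
    have h2 := (list_sum_pos' (wit L M 1 n) (y :: t) (fun z hz => hv1.pos z (sR z (hyt z hz)).1 (sR z (hyt z hz)).2)).2 (by simp)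
    by_contra hc
    have := h1 (by omega)
    linarith
  have c2' : mid.Pairwise (fun x y => x < y) := by
    simp only [List.cons_append, List.pairwise_cons, List.pairwise_append] at c2
    exact c2.2.1
  obtain ⟨s1, s2, rfl, hs1', hs2'⟩ := sorted_split (L + 1) mid c2'
  have ew : w = (p ++ 1 :: s1) ++ (s2 ++ n :: s) := by rw [e]; simp
  have hu : ∀ x ∈ p ++ 1 :: s1, x ≤ L + 1 := by
    intro x hx
    simp only [List.mem_append, List.mem_cons] at hx
    rcases hx with h | rfl | h
    · exact (pL x h).2
    · omega
    · exact hs1' x h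
  have hv : ∀ x ∈ s2 ++ n :: s, L + 1 < x := by
    intro x hx
    simp only [List.mem_append, List.mem_cons] at hx
    rcases hx with h | rfl | h
    · exact hs2' x h
    · omega
    · exact (sR x h).1
  rw [ew, List.nodup_append] at hnd
  refine ⟨p ++ 1 :: s1, ?_, s2 ++ n :: s, ?_, ew⟩
  · refine BL_of_shape (fun i => i + 1) (· < ·) (fun x y h => by omega) L (fun i j h _ => by omega) p s1 ?_ c1 ?_
    · rw [List.perm_ext_iff_of_nodup hnd.1 (List.nodup_range.map (fun a b h => by simpa using h))]
      intro x
      constructor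
      · intro hx
        have := hu x hx
        have h3 := (hmem x (by rw [ew]; exact List.mem_append_left _ hx)).1
        simp only [List.mem_map, List.mem_range]
        exact ⟨x - 1, by omega, by omega⟩
      · intro hx
        simp only [List.mem_map, List.mem_range] at hx
        obtain ⟨i, hi, rfl⟩ := hx
        have : i + 1 ∈ w := by rw [hw.mem_iff, List.mem_range'_1]; omega
        rw [ew, List.mem_append] at this
        rcases this with h | h
        · exact h
        · have := hv _ h; omega
    · have : 1 :: (s1 ++ s2) ++ [n] = (1 :: s1) ++ (s2 ++ [n]) := by simp
      rw [this, List.pairwise_append] at c2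
      exact c2.1
  · have := BL_of_shape (fun i => n - i) (· > ·) (fun x y h => by omega) M (fun i j h _ => by simp; omega) s2 s ?_ ?_ c3
    · exact this
    · change (s2 ++ n :: s).Perm _
      rw [List.perm_ext_iff_of_nodup hnd.2.1]
      · intro x
        constructor
        · intro hx
          have := hv x hx
          have h3 := (hmem x (by rw [ew]; exact List.mem_append_right _ hx)).2
          simp only [List.mem_map, List.mem_range]
          exact ⟨n - x, by omega, by omega⟩
        · intro hx
          simp only [List.mem_map, List.mem_range] at hx
          obtain ⟨i, hi, rfl⟩ := hx
          have : n - i ∈ w := by rw [hw.mem_iff, List.mem_range'_1]; omega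
          rw [ew, List.mem_append] at this
          rcases this with h | h
          · have := hu _ h; omega
          · exact h
      · apply List.Nodup.map_on _ List.nodup_range
        intro x hx y hy h
        simp only [List.mem_range] at hx hy
        omega
    · have : 1 :: (s1 ++ s2) ++ [n] = (1 :: s1) ++ (s2 ++ [n]) := by simp
      rw [this, List.pairwise_append] at c2
      exact c2.2.1

lemma split_notmem {A B P Q : List ℕ} {z : ℕ} (h : A ++ z :: B = P ++ Q) (hz : z ∉ P) :
    ∃ A', A = P ++ A' ∧ Q = A' ++ z :: B := by
  rcases List.append_eq_append_iff.1 h with ⟨a', h1, h2⟩ | ⟨c', h1, h2⟩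
  · cases a' with
    | nil => exact ⟨[], by simpa using h1.symm, by simpa using h2.symm⟩
    | cons w a' =>
      exfalso
      simp only [List.cons_append, List.cons.injEq] at h2
      exact hz (by rw [h1, h2.1]; simp)
  · exact ⟨c', h1, h2⟩

lemma split_mem {A B P Q : List ℕ} {z : ℕ} (h : A ++ z :: B = P ++ Q) (hz : z ∉ Q) :
    ∃ B', P = A ++ z :: B' ∧ B = B' ++ Q := by
  rcases List.append_eq_append_iff.1 h with ⟨a', h1, h2⟩ | ⟨c', h1, h2⟩
  · cases a' with
    | nil => exfalso; exact hz (by simp at h2; rw [← h2]; simp)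
    | cons w a' =>
      simp only [List.cons_append, List.cons.injEq] at h2
      exact ⟨a', by rw [h1, h2.1], h2.2⟩
  · exfalso; exact hz (by rw [h2]; simp)

lemma last_mem {A B P : List ℕ} {x : ℕ} (h : P ++ [x] = A ++ B) (hB : B ≠ []) : x ∈ B := by
  have h5 : (A ++ B).getLast? = some x := by rw [← h]; exact List.getLast?_concat
  rw [List.getLast?_append_of_ne_nil _ hB] at h5
  exact List.mem_of_getLast? h5

lemma good_of_shape (L M n : ℕ) (hn : n = L + M + 2) (u v : List ℕ)
    (hu : u ∈ BL (fun i => i + 1) L) (hv : v ∈ BL (fun i => n - i) M)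
    (hw : (u ++ v).Perm (List.range' 1 n)) : Good n (L + 1) (u ++ v) := by
  have hnd : (u ++ v).Nodup := hw.nodup_iff.2 List.nodup_range'
  have hmem : ∀ x ∈ u ++ v, 1 ≤ x ∧ x ≤ n := by
    intro x hx
    rw [hw.mem_iff, List.mem_range'_1] at hx
    omega
  have huL : ∀ x ∈ u, x ≤ L + 1 := by
    intro x hx
    obtain ⟨i, hi, rfl⟩ := (BL_mem_iff hu x).1 hx
    omega
  have hvL : ∀ x ∈ v, L + 1 < x := by
    intro x hx
    obtain ⟨i, hi, rfl⟩ := (BL_mem_iff hv x).1 hx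
    omega
  obtain ⟨p, a, eu, c1, c2⟩ := BL_shape (fun i => i + 1) (· < ·) L (fun i j h _ => by omega) u hu
  obtain ⟨c, s, ev, d1, d2⟩ := BL_shape (fun i => n - i) (· > ·) M (fun i j h _ => by simp; omega) v hv
  simp only [Nat.zero_add, Nat.sub_zero] at eu ev c1 c2 d1 d2
  have pL : ∀ x ∈ p, 2 ≤ x ∧ x ≤ L + 1 := by
    intro x hx
    refine ⟨?_, huL x (by rw [eu]; simp [hx])⟩
    have := (List.pairwise_append.1 c1).2.2 x hx 1 (by simp)
    omega
  have sR : ∀ x ∈ s, L + 1 < x ∧ x < n := by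
    intro x hx
    exact ⟨hvL x (by rw [ev]; simp [hx]), (List.pairwise_cons.1 d2).1 x hx⟩
  have c3 : ((1 :: (a ++ c)) ++ [n]).Pairwise (· < ·) := by
    have : (1 :: (a ++ c)) ++ [n] = (1 :: a) ++ (c ++ [n]) := by simp
    rw [this, List.pairwise_append]
    refine ⟨c2, d1, ?_⟩
    intro x hx y hy
    have h1 := huL x (by rw [eu]; exact List.mem_append_right _ hx)
    have h2 := hvL y (by rw [ev]; simp at hy ⊢; tauto)
    omega
  intro f hf P x y t e
  have e0 : u ++ v = (P ++ [x]) ++ (y :: t) := by rw [e]; simp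
  have e1 : p ++ 1 :: (a ++ c ++ n :: s) = (P ++ [x]) ++ (y :: t) := by
    rw [← e0, eu, ev]; simp
  have hnd2 := hnd
  rw [e0, List.nodup_append] at hnd2
  by_cases h1 : 1 ∈ P ++ [x]
  · have h1' : 1 ∉ y :: t := fun h => hnd2.2.2 1 h1 1 h rfl
    by_cases h2 : n ∈ P ++ [x]
    · have h2' : n ∉ y :: t := fun h => hnd2.2.2 n h2 n h rfl
      have e2 : (p ++ 1 :: (a ++ c)) ++ n :: s = (P ++ [x]) ++ (y :: t) := by
        rw [← e1]; simp
      obtain ⟨B', h3, h4⟩ := split_mem e2 h2'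
      have hx : x ∈ n :: B' := last_mem h3 (by simp)
      have hxy : y < x := by
        rw [h4, ← List.cons_append, List.pairwise_append] at d2
        exact d2.2.2 x hx y (by simp)
      have h5 := sum_split hf (e0 ▸ hw)
      have h6 := (list_sum_pos' f (y :: t) (fun z hz => hf.pos z (sR z (by rw [h4]; exact List.mem_append_right _ hz)).1
        (sR z (by rw [h4]; exact List.mem_append_right _ hz)).2)).1
      exact ⟨fun h => by omega, fun _ => by linarith⟩
    · obtain ⟨B', h3, h4⟩ := split_mem e1 h1'
      have hx : x ∈ 1 :: B' := last_mem h3 (by simp)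
      have h5 : n ∉ B' := fun h => h2 (by rw [h3]; simp [h])
      obtain ⟨A', h6, h7⟩ := split_notmem h4 h5
      have hxy : x < y := by
        have : (1 :: (a ++ c)) ++ [n] = (1 :: B') ++ (A' ++ [n]) := by rw [h6]; simp
        rw [this, List.pairwise_append] at c3
        apply c3.2.2 x hx y
        cases A' with
        | nil => simp at h7; simp [h7.1]
        | cons z A' => simp at h7; simp [h7.1]
      have h8 := sum_A (by omega) hf hnd2.1 (fun z hz => hmem z (by rw [e0]; exact List.mem_append_left _ hz)) h1 h2
      exact ⟨fun _ => h8.le, fun h => by omega⟩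
  · obtain ⟨A', h3, h4⟩ := split_notmem e1 h1
    have hxy : y < x := by
      have : p ++ [1] = (P ++ [x]) ++ (A' ++ [1]) := by rw [h3]; simp
      rw [this, List.pairwise_append] at c1
      apply c1.2.2 x (by simp) y
      cases A' with
      | nil => simp at h4; simp [h4.1]
      | cons z A' => simp at h4; simp [h4.1]
    have h6 := (list_sum_neg f (P ++ [x]) (fun z hz => hf.neg z (pL z (by rw [h3]; exact List.mem_append_left _ hz)).1
        (pL z (by rw [h3]; exact List.mem_append_left _ hz)).2)).1
    exact ⟨fun h => by omega, fun _ => h6⟩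

lemma good_iff (L M n : ℕ) (hn : n = L + M + 2) (w : List ℕ)
    (hw : w.Perm (List.range' 1 n)) : Good n (L + 1) w ↔ w ∈ WS n L M := by
  have hw' : w.reverse.Perm (List.range' 1 n) := (List.reverse_perm w).trans hw
  simp only [WS, Finset.mem_union, Finset.mem_image, Finset.mem_product, List.mem_toFinset, Prod.exists]
  constructor
  · intro hg
    have m1 : 1 ∈ w := by rw [hw.mem_iff, List.mem_range'_1]; omega
    have mn : n ∈ w := by rw [hw.mem_iff, List.mem_range'_1]; omega
    obtain ⟨p, r, e⟩ := List.append_of_mem m1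
    rw [e] at mn
    simp only [List.mem_append, List.mem_cons] at mn
    rcases mn with h | h | h
    · right
      obtain ⟨p1, p2, rfl⟩ := List.append_of_mem h
      obtain ⟨u, hu, v, hv, h⟩ := shape_of_good L M n hn w.reverse hw' (good_reverse hw hg) r.reverse p2.reverse p1.reverse
        (by rw [e]; simp)
      refine ⟨u.reverse, v.reverse, ⟨BL_reverse _ _ u hu, BL_reverse _ _ v hv⟩, ?_⟩
      rw [← List.reverse_append, ← h, List.reverse_reverse]
    · omega
    · left
      obtain ⟨p1, p2, rfl⟩ := List.append_of_mem h
      obtain ⟨u, hu, v, hv, h⟩ := shape_of_good L M n hn w hw hg p p1 p2 e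
      exact ⟨u, v, ⟨hu, hv⟩, h.symm⟩
  · rintro (⟨u, v, ⟨hu, hv⟩, rfl⟩ | ⟨u, v, ⟨hu, hv⟩, rfl⟩)
    · exact good_of_shape L M n hn u v hu hv hw
    · have := good_of_shape L M n hn u.reverse v.reverse (BL_reverse _ _ u hu) (BL_reverse _ _ v hv) (by simpa using hw')
      have := good_reverse (by simpa using hw') this
      simpa using this

lemma WS_perm (L M n : ℕ) (hn : n = L + M + 2) (w : List ℕ) (h : w ∈ WS n L M) :
    w.Perm (List.range' 1 n) := by
  simp only [WS, Finset.mem_union, Finset.mem_image, Finset.mem_product, List.mem_toFinset, Prod.exists] at h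
  have key : ∀ u v, u ∈ BL (fun i => i + 1) L → v ∈ BL (fun i => n - i) M →
      (u ++ v).Perm (List.range' 1 n) := by
    intro u v hu hv
    have h1 := (BL_perm _ _ u hu).append (BL_perm _ _ v hv)
    refine h1.trans ?_
    rw [List.perm_ext_iff_of_nodup]
    · intro x
      simp only [List.mem_append, List.mem_map, List.mem_range, List.mem_range'_1]
      constructor
      · rintro (⟨i, hi, rfl⟩ | ⟨i, hi, rfl⟩) <;> omega
      · intro hx
        by_cases hc : x ≤ L + 1
        · left; exact ⟨x - 1, by omega, by omega⟩
        · right; exact ⟨n - x, by omega, by omega⟩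
    · rw [List.nodup_append]
      refine ⟨List.nodup_range.map (fun a b h => by simpa using h), ?_, ?_⟩
      · apply List.Nodup.map_on _ List.nodup_range
        intro x hx y hy h
        simp only [List.mem_range] at hx hy
        omega
      · intro x hx y hy
        simp only [List.mem_map, List.mem_range] at hx hy
        obtain ⟨i, hi, rfl⟩ := hx
        obtain ⟨j, hj, rfl⟩ := hy
        omega
    · exact List.nodup_range'
  rcases h with ⟨u, v, ⟨hu, hv⟩, rfl⟩ | ⟨u, v, ⟨hu, hv⟩, rfl⟩
  · exact key u v hu hv
  · exact List.perm_append_comm.trans (key u v hu hv)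

lemma rootsum_apply (N : ℕ) (a : ℕ → ℝ) (k : ℕ) :
    (∑ i ∈ Finset.Icc 1 N, a i • rootR i (i + 1)) k =
      (if 1 ≤ k ∧ k ≤ N then a k else 0) - (if 2 ≤ k ∧ k ≤ N + 1 then a (k - 1) else 0) := by
  induction N with
  | zero =>
    rw [if_neg (by omega), if_neg (by omega)]; simp
  | succ N ih =>
    rw [Finset.sum_Icc_succ_top (by omega), Pi.add_apply, ih, Pi.smul_apply, smul_eq_mul, rootR]
    rcases lt_trichotomy k (N + 1) with h | h | h
    · have e1 : (1 ≤ k ∧ k ≤ N) ↔ (1 ≤ k ∧ k ≤ N + 1) := by omega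
      have e2 : (2 ≤ k ∧ k ≤ N + 1) ↔ (2 ≤ k ∧ k ≤ N + 1 + 1) := by omega
      rw [if_neg (by omega : ¬ k = N + 1), if_neg (by omega : ¬ k = N + 1 + 1)]
      simp only [e1, e2]; ring
    · subst h
      rw [if_neg (by omega : ¬ (1 ≤ N + 1 ∧ N + 1 ≤ N)), if_pos (rfl : N + 1 = N + 1),
        if_neg (by omega : ¬ (N + 1 = N + 1 + 1)), if_pos (by omega : 1 ≤ N + 1 ∧ N + 1 ≤ N + 1)]
      have e2 : (2 ≤ N + 1 ∧ N + 1 ≤ N + 1) ↔ (2 ≤ N + 1 ∧ N + 1 ≤ N + 1 + 1) := by omega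
      simp only [e2]; ring
    · by_cases h' : k = N + 1 + 1
      · subst h'
        rw [if_neg (by omega), if_neg (by omega), if_neg (by omega), if_pos rfl, if_neg (by omega),
          if_pos (by omega)]
        simp
      · rw [if_neg (by omega), if_neg (by omega), if_neg (by omega), if_neg (by omega),
          if_neg (by omega), if_neg (by omega)]
        simp

lemma rootsum_iff (n : ℕ) (hn : 2 ≤ n) (a u : ℕ → ℝ) :
    u = ∑ i ∈ Finset.Icc 1 (n - 1), a i • rootR i (i + 1) ↔
      (∀ j, 1 ≤ j → j ≤ n - 1 → ∑ k ∈ Finset.Icc 1 j, u k = a j) ∧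
      ∑ k ∈ Finset.Icc 1 n, u k = 0 ∧ ∀ k, k ∉ Finset.Icc 1 n → u k = 0 := by
  have hn1 : n - 1 + 1 = n := by omega
  constructor
  · intro h
    have hu : ∀ k, u k = _ := fun k => (congrFun h k).trans (rootsum_apply _ _ _)
    rw [hn1] at hu
    have tele : ∀ j, j ≤ n → ∑ k ∈ Finset.Icc 1 j, u k = if 1 ≤ j ∧ j ≤ n - 1 then a j else 0 := by
      intro j
      induction j with
      | zero => intro _; simp
      | succ j ih =>
        intro hj
        rw [Finset.sum_Icc_succ_top (by omega), ih (by omega), hu]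
        have : (2 ≤ j + 1 ∧ j + 1 ≤ n) ↔ (1 ≤ j ∧ j ≤ n - 1) := by omega
        simp only [this, Nat.add_sub_cancel]
        ring
    refine ⟨?_, ?_, ?_⟩
    · intro j h1 h2
      rw [tele j (by omega), if_pos ⟨h1, h2⟩]
    · rw [tele n le_rfl, if_neg (by omega)]
    · intro k hk
      simp only [Finset.mem_Icc] at hk
      rw [hu, if_neg (by omega), if_neg (by omega)]; ring
  · rintro ⟨h1, h2, h3⟩
    funext k
    rw [rootsum_apply, hn1]
    by_cases hk : k ∈ Finset.Icc 1 n
    · simp only [Finset.mem_Icc] at hk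
      obtain ⟨k, rfl⟩ : ∃ j, k = j + 1 := ⟨k - 1, by omega⟩
      have e1 : (if 1 ≤ k + 1 ∧ k + 1 ≤ n - 1 then a (k + 1) else 0) = ∑ i ∈ Finset.Icc 1 (k + 1), u i := by
        split_ifs with h
        · rw [h1 _ h.1 h.2]
        · rw [show k + 1 = n by omega, h2]
      have e2 : (if 2 ≤ k + 1 ∧ k + 1 ≤ n then a (k + 1 - 1) else 0) = ∑ i ∈ Finset.Icc 1 k, u i := by
        split_ifs with h
        · rw [h1 _ (by omega) (by omega)]; rfl
        · rw [show k = 0 by omega]; simp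
      rw [e1, e2, Finset.sum_Icc_succ_top (by omega)]; ring
    · rw [h3 k hk]
      simp only [Finset.mem_Icc] at hk
      rw [if_neg (by omega), if_neg (by omega)]; ring

lemma Cm_iff (n m : ℕ) (hn : 2 ≤ n) (hm1 : 1 ≤ m) (hm2 : m ≤ n - 1) (v : ℕ → ℝ) :
    v ∈ Cm n m ↔ Ch n (n - m) v := by
  constructor
  · rintro ⟨a, h1, h2, h3, h4⟩
    obtain ⟨g1, g2, g3⟩ := (rootsum_iff n hn a v).1 h4
    have hv : ∀ k, 2 ≤ k → k ≤ n - 1 → v k = a k - a (k - 1) := by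
      intro k hk hk'
      obtain ⟨k, rfl⟩ : ∃ j, k = j + 1 := ⟨k - 1, by omega⟩
      have e1 := g1 (k + 1) (by omega) hk'
      rw [Finset.sum_Icc_succ_top (by omega), g1 k (by omega) (by omega)] at e1
      simp only [Nat.add_sub_cancel]; linarith
    refine ⟨?_, ?_, ?_, g2, g3⟩
    · intro k hk hk'
      have := h1 (k - 1) (by omega) (by omega)
      rw [show k - 1 + 1 = k by omega] at this
      rw [hv k hk (by omega)]; linarith
    · intro k hk hk'
      have := h2 (k - 1) (by omega) (by omega)
      rw [show k - 1 + 1 = k by omega] at this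
      rw [hv k (by omega) (by omega)]; linarith
    · rw [g1 _ (by omega) (by omega)]; exact h3
  · intro h
    refine ⟨fun i => ∑ k ∈ Finset.Icc 1 i, v k, ?_, ?_, h.sl, ?_⟩
    · intro i hi hi'
      have := h.neg (i + 1) (by omega) hi'
      simp only
      rw [Finset.sum_Icc_succ_top (by omega)]; linarith
    · intro i hi hi'
      have := h.pos (i + 1) (by omega) (by omega)
      simp only
      rw [Finset.sum_Icc_succ_top (by omega)]; linarith
    · rw [rootsum_iff n hn]
      exact ⟨fun _ _ _ => rfl, h.s0, h.out⟩

lemma SB_mem {n : ℕ} {w : Equiv.Perm ℕ} (hw : w ∈ SB 1 n) (k : ℕ) :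
    w k ∈ Finset.Icc 1 n ↔ k ∈ Finset.Icc 1 n := by
  constructor
  · intro h
    by_contra hk
    rw [hw k hk] at h
    exact hk h
  · intro h
    by_contra hk
    have := w.injective (hw _ hk)
    rw [this] at hk
    exact hk h

lemma SB_sum {M : Type*} [AddCommMonoid M] {n : ℕ} {w : Equiv.Perm ℕ} (hw : w ∈ SB 1 n) (f : ℕ → M) :
    ∑ k ∈ Finset.Icc 1 n, f (w k) = ∑ k ∈ Finset.Icc 1 n, f k :=
  Finset.sum_equiv w (fun k => (SB_mem hw k).symm) (fun _ _ => rfl)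

def wordOf (n : ℕ) (w : Equiv.Perm ℕ) : List ℕ := (List.range' 1 n).map w

lemma wordOf_perm {n : ℕ} {w : Equiv.Perm ℕ} (hw : w ∈ SB 1 n) :
    (wordOf n w).Perm (List.range' 1 n) := by
  rw [wordOf, List.perm_ext_iff_of_nodup (List.Nodup.map w.injective List.nodup_range') List.nodup_range']
  intro x
  have hI : ∀ y, y ∈ List.range' 1 n ↔ y ∈ Finset.Icc 1 n := by
    intro y; rw [List.mem_range'_1, Finset.mem_Icc]; omega
  rw [List.mem_map]
  constructor
  · rintro ⟨y, hy, rfl⟩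
    rw [hI] at hy ⊢; rwa [SB_mem hw]
  · intro hx
    refine ⟨w.symm x, ?_, by simp⟩
    rw [hI] at hx ⊢
    rw [← SB_mem hw]; simpa using hx

noncomputable def sg (w : Equiv.Perm ℕ) (i : ℕ) : ℝ := if w i < w (i + 1) then 1 else -1

lemma absRoot_apply (w : Equiv.Perm ℕ) (i t : ℕ) :
    absRoot w i (w t) = sg w i * rootR i (i + 1) t := by
  simp only [absRoot, rootR, sg]
  by_cases h : w i < w (i + 1)
  · rw [min_eq_left h.le, max_eq_right h.le, if_pos h]
    simp
  · rw [min_eq_right (not_lt.1 h), max_eq_left (not_lt.1 h), if_neg h]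
    simp

lemma cone_iff (n : ℕ) (hn : 2 ≤ n) {w : Equiv.Perm ℕ} (hw : w ∈ SB 1 n) (v : ℕ → ℝ)
    (hs0 : ∑ k ∈ Finset.Icc 1 n, v k = 0) (hout : ∀ k, k ∉ Finset.Icc 1 n → v k = 0) :
    v ∈ ConeB 1 n w ↔ ∀ j, 1 ≤ j → j ≤ n - 1 →
      (w j < w (j + 1) → 0 ≤ ∑ k ∈ Finset.Icc 1 j, v (w k)) ∧
      (w (j + 1) < w j → ∑ k ∈ Finset.Icc 1 j, v (w k) ≤ 0) := by
  have key : ∀ c : ℕ → ℝ, v = ∑ i ∈ Finset.Icc 1 (n - 1), c i • absRoot w i ↔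
      ∀ j, 1 ≤ j → j ≤ n - 1 → ∑ k ∈ Finset.Icc 1 j, v (w k) = c j * sg w j := by
    intro c
    have e := rootsum_iff n hn (fun i => c i * sg w i) (fun t => v (w t))
    have e1 : ∑ k ∈ Finset.Icc 1 n, v (w k) = 0 := by rw [SB_sum hw, hs0]
    have e2 : ∀ k, k ∉ Finset.Icc 1 n → v (w k) = 0 := by
      intro k hk; rw [hw k hk]; exact hout k hk
    simp only [e1, true_and] at e
    refine Iff.trans ?_ (e.trans ?_)
    · constructor
      · intro h
        funext t
        rw [congrFun h (w t)]
        simp only [Finset.sum_apply, Pi.smul_apply, smul_eq_mul, absRoot_apply]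
        exact Finset.sum_congr rfl (fun i _ => by ring)
      · intro h
        funext k
        obtain ⟨t, rfl⟩ := w.surjective k
        rw [congrFun h t]
        simp only [Finset.sum_apply, Pi.smul_apply, smul_eq_mul, absRoot_apply]
        exact Finset.sum_congr rfl (fun i _ => by ring)
    · first
      | exact Iff.rfl
      | exact ⟨fun h => h.1, fun h => ⟨h, e2⟩⟩
  have hsg : ∀ j, w j < w (j + 1) ∧ sg w j = 1 ∨ w (j + 1) < w j ∧ sg w j = -1 := by
    intro j
    by_cases h : w j < w (j + 1)
    · left; exact ⟨h, if_pos h⟩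
    · right
      have : w j ≠ w (j + 1) := fun h' => by have := w.injective h'; omega
      exact ⟨by omega, if_neg h⟩
  constructor
  · rintro ⟨c, hc, h⟩ j h1 h2
    rw [key] at h
    rw [h j h1 h2]
    have := hc j (Finset.mem_Icc.2 ⟨h1, h2⟩)
    rcases hsg j with ⟨a, b⟩ | ⟨a, b⟩ <;> rw [b]
    · exact ⟨fun _ => by linarith, fun _ => by omega⟩
    · exact ⟨fun _ => by omega, fun _ => by linarith⟩
  · intro h
    refine ⟨fun j => (∑ k ∈ Finset.Icc 1 j, v (w k)) * sg w j, ?_, ?_⟩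
    · intro j hj
      rw [Finset.mem_Icc] at hj
      have h' := h j hj.1 hj.2
      simp only
      rcases hsg j with ⟨a, b⟩ | ⟨a, b⟩ <;> rw [b]
      · linarith [h'.1 a]
      · linarith [h'.2 a]
    · rw [key]
      intro j _ _
      rcases hsg j with ⟨a, b⟩ | ⟨a, b⟩ <;> rw [b] <;> ring

lemma range'_sum {M : Type*} [AddCommMonoid M] (j : ℕ) (g : ℕ → M) :
    ((List.range' 1 j).map g).sum = ∑ k ∈ Finset.Icc 1 j, g k := by
  rw [← List.sum_toFinset _ List.nodup_range']
  congr 1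
  ext x; simp [List.mem_range'_1]; omega

lemma wordOf_split (n : ℕ) (w : Equiv.Perm ℕ) (j : ℕ) (h1 : 1 ≤ j) (h2 : j ≤ n - 1) :
    wordOf n w = (List.range' 1 (j - 1)).map w ++ w j :: w (j + 1) :: (List.range' (j + 2) (n - j - 1)).map w := by
  obtain ⟨i, rfl⟩ : ∃ i, j = i + 1 := ⟨j - 1, by omega⟩
  obtain ⟨d, rfl⟩ : ∃ d, n = i + (d + 2) := ⟨n - i - 2, by omega⟩
  rw [wordOf, ← List.range'_append_1, List.map_append]
  have : i + (d + 2) - (i + 1) - 1 = d := by omega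
  rw [this]
  simp [List.range'_succ, Nat.add_comm 1 i]

lemma cone_good (n m : ℕ) (hn : 2 ≤ n) (hm1 : 1 ≤ m) (hm2 : m ≤ n - 1) {w : Equiv.Perm ℕ}
    (hw : w ∈ SB 1 n) : Cm n m ⊆ ConeB 1 n w ↔ Good n (n - m) (wordOf n w) := by
  have hS : ∀ (v : ℕ → ℝ) j, 1 ≤ j → (((List.range' 1 (j - 1)).map w ++ [w j]).map v).sum = ∑ k ∈ Finset.Icc 1 j, v (w k) := by
    intro v j hj
    rw [← range'_sum]
    obtain ⟨i, rfl⟩ : ∃ i, j = i + 1 := ⟨j - 1, by omega⟩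
    simp only [Nat.add_sub_cancel]
    rw [List.range'_concat]
    simp [Nat.add_comm 1 i, Function.comp_def]
  constructor
  · intro h v hv p x y t e
    have h' := (cone_iff n hn hw v hv.s0 hv.out).1 (h ((Cm_iff n m hn hm1 hm2 v).2 hv))
    have hlen : (wordOf n w).length = n := by simp [wordOf]
    have hl2 := hlen
    rw [e] at hl2
    simp at hl2
    have e2 := wordOf_split n w (p.length + 1) (by omega) (by omega)
    rw [e] at e2
    obtain ⟨q1, q2⟩ := List.append_inj e2 (by simp)
    simp only [List.cons.injEq] at q2
    obtain ⟨rfl, rfl, -⟩ := q2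
    have h3 := h' (p.length + 1) (by omega) (by omega)
    rw [← hS v _ (by omega), ← q1] at h3
    exact h3
  · intro h v hv
    have hv := (Cm_iff n m hn hm1 hm2 v).1 hv
    rw [cone_iff n hn hw v hv.s0 hv.out]
    intro j h1 h2
    have := h v hv _ _ _ _ (wordOf_split n w j h1 h2)
    rwa [hS v j h1] at this

lemma ascL_word (w : Equiv.Perm ℕ) (k s : ℕ) :
    ascL ((List.range' s (k + 1)).map w) = ∑ i ∈ Finset.Ico s (s + k), if w i < w (i + 1) then 1 else 0 := by
  induction k generalizing s with
  | zero => simp [ascL]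
  | succ k ih =>
    have := ih (s + 1)
    rw [List.range'_succ, List.map_cons] at this
    rw [List.range'_succ, List.range'_succ, List.map_cons, List.map_cons, ascL, this,
      Finset.sum_eq_sum_Ico_succ_bot (by omega : s < s + (k + 1)), show s + 1 + k = s + (k + 1) by omega]

lemma eps_word (n : ℕ) (hn : 2 ≤ n) (w : Equiv.Perm ℕ) : eps n w = ascL (wordOf n w) := by
  obtain ⟨k, rfl⟩ : ∃ k, n = k + 1 := ⟨n - 1, by omega⟩
  rw [wordOf, ascL_word, eps, Finset.card_filter]
  congr 1
  ext x; simp only [Finset.mem_Icc, Finset.mem_Ico]; omega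

lemma EL_word (b : ℕ → ℤ) (n : ℕ) (w : Equiv.Perm ℕ) :
    EL b (wordOf n w) = ∑ i ∈ Finset.Icc 1 n, (i : ℤ) * b (w i) := by
  induction n with
  | zero => simp [wordOf, EL]
  | succ k ih =>
    rw [wordOf] at ih ⊢
    rw [List.range'_concat, List.map_append, EL_append, ih, Finset.sum_Icc_succ_top (by omega)]
    simp [EL, Nat.add_comm 1 k]
    ring

lemma abel (A : ℕ → ℤ) (hA0 : A 0 = 0) (x : ℕ → ℤ) (j : ℕ) :
    ∑ k ∈ Finset.Icc 1 (j + 1), x k * (A k - A (k - 1)) =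
      A (j + 1) * x (j + 1) - ∑ i ∈ Finset.Icc 1 j, A i * (x (i + 1) - x i) := by
  induction j with
  | zero => simp [hA0]; ring
  | succ j ih =>
    rw [Finset.sum_Icc_succ_top (by omega), ih, Finset.sum_Icc_succ_top (by omega)]
    simp only [Nat.add_sub_cancel]
    ring

lemma D_word (n : ℕ) (hn : 2 ≤ n) (w : Equiv.Perm ℕ) (hw : w ∈ SB 1 n) (a A : ℕ → ℤ) (hA0 : A 0 = 0)
    (hAn : A n = 0) (hA : ∀ i ∈ Finset.Icc 1 (n - 1), A i = a i) :
    -D (n - 1) w a = EL (fun k => A k - A (k - 1)) (wordOf n w) := by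
  rw [EL_word]
  have h1 := SB_sum hw (fun k => ((w⁻¹ k : ℕ) : ℤ) * (A k - A (k - 1)))
  have e : ∀ k, w⁻¹ (w k) = k := fun k => by simp
  simp only [e] at h1
  rw [h1]
  have h2 := abel A hA0 (fun k => ((w⁻¹ k : ℕ) : ℤ)) (n - 1)
  rw [show n - 1 + 1 = n by omega, hAn] at h2
  rw [h2, D, zero_mul, zero_sub]
  congr 1
  apply Finset.sum_congr rfl
  intro i hi
  rw [hA i hi]

lemma word_inj (n : ℕ) : Set.InjOn (wordOf n) (SB 1 n) := by
  intro w hw w' hw' h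
  ext k
  by_cases hk : k ∈ Finset.Icc 1 n
  · rw [wordOf, wordOf, List.map_inj_left] at h
    exact h k (by rw [List.mem_range'_1]; rw [Finset.mem_Icc] at hk; omega)
  · rw [hw k hk, hw' k hk]

lemma word_surj (n : ℕ) (l : List ℕ) (hl : l.Perm (List.range' 1 n)) :
    ∃ w ∈ SB 1 n, wordOf n w = l := by
  have hlen : l.length = n := by rw [hl.length_eq]; simp
  have hnd : l.Nodup := hl.nodup_iff.2 List.nodup_range'
  have hmem : ∀ x, x ∈ l ↔ 1 ≤ x ∧ x ≤ n := by
    intro x; rw [hl.mem_iff, List.mem_range'_1]; omega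
  let f : ℕ → ℕ := fun k => if h : 1 ≤ k ∧ k ≤ n then l[k - 1]'(by omega) else k
  have hin : ∀ k, 1 ≤ k ∧ k ≤ n → 1 ≤ f k ∧ f k ≤ n := by
    intro k h
    rw [← hmem]
    simp only [f, dif_pos h]
    exact List.getElem_mem _
  have hout : ∀ k, ¬ (1 ≤ k ∧ k ≤ n) → f k = k := by
    intro k h
    simp only [f, dif_neg h]
  have hbij : Function.Bijective f := by
    constructor
    · intro x y h
      by_cases hx : 1 ≤ x ∧ x ≤ n <;> by_cases hy : 1 ≤ y ∧ y ≤ n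
      · simp only [f, dif_pos hx, dif_pos hy] at h
        have := (hnd.getElem_inj_iff).1 h
        omega
      · have := hin x hx; rw [h, hout y hy] at this; omega
      · have := hin y hy; rw [← h, hout x hx] at this; omega
      · rwa [hout x hx, hout y hy] at h
    · intro y
      by_cases hy : 1 ≤ y ∧ y ≤ n
      · obtain ⟨i, hi, rfl⟩ := List.getElem_of_mem ((hmem y).2 hy)
        refine ⟨i + 1, ?_⟩
        simp only [f]
        rw [dif_pos (by omega)]
        simp
      · exact ⟨y, hout y hy⟩
  refine ⟨Equiv.ofBijective f hbij, ?_, ?_⟩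
  · intro k hk
    rw [Finset.mem_Icc] at hk
    exact hout k hk
  · apply List.ext_getElem
    · simp [wordOf, hlen]
    · intro i h1 h2
      simp only [wordOf, List.getElem_map, List.getElem_range', Equiv.ofBijective_apply, f]
      rw [dif_pos (by omega)]
      simp

theorem residue_sum_over_Wm (n m : ℕ) (hn : 2 ≤ n) (hm1 : 1 ≤ m) (hm2 : m ≤ n - 1)
    (a : ℕ → ℤ) (hposall : ∀ i ∈ Finset.Icc 1 (n - 1), 0 < a i)
    (hdec : ∀ i, 1 ≤ i → i + 1 ≤ n - m → a (i + 1) < a i)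
    (hinc : ∀ i, n - m ≤ i → i + 1 ≤ n - 1 → a i < a (i + 1)) :
    (∑ᶠ w ∈ Wm n m, (-1 : RatFunc ℚ) ^ eps n w * q ^ (-D (n - 1) w a)) =
      q ^ (-(∑ i ∈ Finset.Icc 1 (n - 1), a i)) * (q ^ ((n : ℤ) * a (n - m)) - 1) *
        (∏ i ∈ Finset.Icc 1 (n - m - 1), (q ^ (((i : ℤ) + 1) * a i - (i : ℤ) * a (i + 1)) - 1)) *
        (∏ j ∈ Finset.Icc 1 (m - 1), (q ^ (((j : ℤ) + 1) * a (n - j) - (j : ℤ) * a (n - j - 1)) - 1)) := by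
  obtain ⟨L, M, hnLM, hL, hM⟩ : ∃ L M, n = L + M + 2 ∧ n - m = L + 1 ∧ m = M + 1 :=
    ⟨n - m - 1, m - 1, by omega, by omega, by omega⟩
  let A : ℕ → ℤ := fun k => if 1 ≤ k ∧ k ≤ n - 1 then a k else 0
  have hA : ∀ k, 1 ≤ k → k ≤ n - 1 → A k = a k := fun k h1 h2 => if_pos ⟨h1, h2⟩
  have hA0 : A 0 = 0 := if_neg (by omega)
  have hAn : A n = 0 := if_neg (by omega)
  have hbij : Set.BijOn (wordOf n) (Wm n m) (WS n L M : Set (List ℕ)) := by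
    refine ⟨?_, (word_inj n).mono (fun w hw => hw.1), ?_⟩
    · rintro w ⟨h1, h2⟩
      rw [cone_good n m hn hm1 hm2 h1, hL] at h2
      exact (good_iff L M n hnLM _ (wordOf_perm h1)).1 h2
    · intro l hl
      have hp := WS_perm L M n hnLM l hl
      obtain ⟨w, hw, rfl⟩ := word_surj n l hp
      refine ⟨w, ⟨hw, ?_⟩, rfl⟩
      rw [cone_good n m hn hm1 hm2 hw, hL]
      exact (good_iff L M n hnLM _ hp).2 hl
  rw [finsum_mem_eq_of_bijOn (wordOf n) hbij (g := wt (fun k => A k - A (k - 1))), finsum_mem_coe_finset,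
    WS_sum A n L M hnLM hA0 hAn]
  · rw [hL, show L + 1 - 1 = L by omega, show m - 1 = M by omega]
    congr 1
    · congr 1
      · congr 1
        · congr 2
          apply Finset.sum_congr rfl
          intro i hi
          rw [Finset.mem_Icc] at hi
          exact hA i hi.1 hi.2
        · rw [hA (L + 1) (by omega) (by omega)]
      · apply Finset.prod_congr rfl
        intro i hi
        rw [Finset.mem_Icc] at hi
        rw [hA i (by omega) (by omega), hA (i + 1) (by omega) (by omega)]
    · apply Finset.prod_congr rfl
      intro j hj
      rw [Finset.mem_Icc] at hj
      rw [hA (n - j) (by omega) (by omega), hA (n - j - 1) (by omega) (by omega)]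
  · rintro w ⟨h1, -⟩
    rw [wt, eps_word n hn, D_word n hn w h1 a A hA0 hAn
      (fun i hi => by rw [Finset.mem_Icc] at hi; exact hA i hi.1 hi.2)]
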